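/- Let M be a finitely generated R-module with projective presentation P_1 →f P_0 → M → 0, and let tr_ω M := coker(f† : P_0† → P_1†) be the ω-transpose of M. Then coker δ_M ≅ Ext^2_R(tr_ω M, ω), where δ_M : M → M†† is the natural evaluation homomorphism. -/

import Mathlib

open CategoryTheory

noncomputable section

/-- `Ext^n_A(M, N)` as a module. -/
def ext1 (A : Type) [CommRing A] (n : ℕ) (M N : Type) [AddCommGroup M] [Module A M]
    [AddCommGroup N] [Module A N] : ModuleCat A :=
  ((Ext A (ModuleCat A) n).obj (Opposite.op (ModuleCat.of A M))).obj (ModuleCat.of A N)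

/-- The depth of a module over a local ring: the least `n` with `Ext^n(k, M) ≠ 0`
(`⊤` if no such `n`, e.g. for the zero module). -/
def rdepth (A : Type) [CommRing A] [IsLocalRing A] (M : Type) [AddCommGroup M] [Module A M] :
    ℕ∞ :=
  sInf {n : ℕ∞ | ∃ m : ℕ, n = m ∧ ¬ Subsingleton (ext1 A m (IsLocalRing.ResidueField A) M)}

/-- The dimension of a module, `dim M = dim (A / ann M)`. -/
def mdim (A : Type) [CommRing A] (M : Type) [AddCommGroup M] [Module A M] : WithBot ℕ∞ :=
  ringKrullDim (A ⧸ Module.annihilator A M)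

/-- `cod M > n`, i.e. `dim A - dim M > n`, i.e. `dim M + n < d`. -/
def codGT (A : Type) [CommRing A] (d : ℕ) (M : Type) [AddCommGroup M] [Module A M]
    (n : ℕ) : Prop :=
  mdim A M + n < (d : WithBot ℕ∞)

/-- `cod M ≥ n`, i.e. `dim M + n ≤ d`. -/
def codGE (A : Type) [CommRing A] (d : ℕ) (M : Type) [AddCommGroup M] [Module A M]
    (n : ℕ) : Prop :=
  mdim A M + n ≤ (d : WithBot ℕ∞)

/-- Maximal Cohen-Macaulay module over a `d`-dimensional local ring
(the zero module counts as MCM). -/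
def IsMCM (A : Type) [CommRing A] [IsLocalRing A] (d : ℕ) (M : Type) [AddCommGroup M]
    [Module A M] : Prop :=
  Module.Finite A M ∧ (d : ℕ∞) ≤ rdepth A M

/-- Serre's condition `(S_n)`: `depth M_p ≥ min {n, ht p}` for all primes `p`. -/
def SerreS (A : Type) [CommRing A] (n : ℕ) (M : Type) [AddCommGroup M] [Module A M] : Prop :=
  ∀ p : PrimeSpectrum A,
    min (n : WithBot ℕ∞) (ringKrullDim (Localization.AtPrime p.asIdeal))
      ≤ (rdepth (Localization.AtPrime p.asIdeal)
          (LocalizedModule p.asIdeal.primeCompl M) : ℕ∞)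

/-- Finite injective dimension: `Ext^m(-, M)` vanishes for all large `m`. -/
def HasFID (A : Type) [CommRing A] (M : Type) [AddCommGroup M] [Module A M] : Prop :=
  ∃ n : ℕ, ∀ (N : Type) [AddCommGroup N] [Module A N], ∀ m : ℕ, n < m →
    Subsingleton (ext1 A m N M)

/-- `ω` is a canonical module of the `d`-dimensional local ring `A`:
it is maximal Cohen-Macaulay, of finite injective dimension, and of type one. -/
def IsCanonicalModule (A : Type) [CommRing A] [IsLocalRing A] (d : ℕ) (ω : Type)
    [AddCommGroup ω] [Module A ω] : Prop :=
  IsMCM A d ω ∧ HasFID A ω ∧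
    Nonempty ((ext1 A d (IsLocalRing.ResidueField A) ω) ≃ₗ[A] IsLocalRing.ResidueField A)

/-- `μ : M → X` is a CM-preenvelope. -/
def IsCMPreenvelope (A : Type) [CommRing A] [IsLocalRing A] (d : ℕ) {M X : Type}
    [AddCommGroup M] [Module A M] [AddCommGroup X] [Module A X] (μ : M →ₗ[A] X) : Prop :=
  IsMCM A d X ∧ ∀ (Z : Type) [AddCommGroup Z] [Module A Z], IsMCM A d Z →
    ∀ f : M →ₗ[A] Z, ∃ g : X →ₗ[A] Z, g ∘ₗ μ = f

/-- `μ : M → X` is a special CM-preenvelope: a CM-preenvelope with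
`Ext^1(coker μ, Z) = 0` for all maximal Cohen-Macaulay `Z`. -/
def IsSpecialCMPreenvelope (A : Type) [CommRing A] [IsLocalRing A] (d : ℕ) {M X : Type}
    [AddCommGroup M] [Module A M] [AddCommGroup X] [Module A X] (μ : M →ₗ[A] X) : Prop :=
  IsCMPreenvelope A d μ ∧ ∀ (Z : Type) [AddCommGroup Z] [Module A Z], IsMCM A d Z →
    Subsingleton (ext1 A 1 (X ⧸ LinearMap.range μ) Z)

/-- `μ : M → X` is a CM-envelope. -/
def IsCMEnvelope (A : Type) [CommRing A] [IsLocalRing A] (d : ℕ) {M X : Type}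
    [AddCommGroup M] [Module A M] [AddCommGroup X] [Module A X] (μ : M →ₗ[A] X) : Prop :=
  IsCMPreenvelope A d μ ∧ ∀ φ : X →ₗ[A] X, φ ∘ₗ μ = μ → Function.Bijective φ

/-- `π : X → M` is a CM-precover. -/
def IsCMPrecover (A : Type) [CommRing A] [IsLocalRing A] (d : ℕ) {X M : Type}
    [AddCommGroup X] [Module A X] [AddCommGroup M] [Module A M] (π : X →ₗ[A] M) : Prop :=
  IsMCM A d X ∧ ∀ (Z : Type) [AddCommGroup Z] [Module A Z], IsMCM A d Z →
    ∀ f : Z →ₗ[A] M, ∃ g : Z →ₗ[A] X, π ∘ₗ g = f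

/-- `π : X → M` is a special CM-precover: a CM-precover with
`Ext^1(Z, ker π) = 0` for all maximal Cohen-Macaulay `Z`. -/
def IsSpecialCMPrecover (A : Type) [CommRing A] [IsLocalRing A] (d : ℕ) {X M : Type}
    [AddCommGroup X] [Module A X] [AddCommGroup M] [Module A M] (π : X →ₗ[A] M) : Prop :=
  IsCMPrecover A d π ∧ ∀ (Z : Type) [AddCommGroup Z] [Module A Z], IsMCM A d Z →
    Subsingleton (ext1 A 1 Z ↥(LinearMap.ker π))

/-- `π : X → M` is a CM-cover. -/
def IsCMCover (A : Type) [CommRing A] [IsLocalRing A] (d : ℕ) {X M : Type}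
    [AddCommGroup X] [Module A X] [AddCommGroup M] [Module A M] (π : X →ₗ[A] M) : Prop :=
  IsCMPrecover A d π ∧ ∀ φ : X →ₗ[A] X, π ∘ₗ φ = π → Function.Bijective φ

/-- `M` has no nonzero free direct summand. -/
def NoNonzeroFreeSummand (A : Type) [CommRing A] (M : Type) [AddCommGroup M]
    [Module A M] : Prop :=
  ∀ F G : Submodule A M, IsCompl F G → Module.Free A ↥F → F = ⊥

/-- `W` belongs to `add ω`: it is a direct summand of a finite direct sum of copies of `ω`. -/
def InAdd (A : Type) [CommRing A] (ω : Type) [AddCommGroup ω] [Module A ω] (W : Type)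
    [AddCommGroup W] [Module A W] : Prop :=
  ∃ (n : ℕ) (W' : ModuleCat.{0} A), Nonempty ((W × ↥W') ≃ₗ[A] (Fin n → ω))

section delta

variable (A : Type) [CommRing A] (ω : Type) [AddCommGroup ω] [Module A ω]

/-- The natural evaluation map `δ_M : M → M†† = Hom(Hom(M, ω), ω)`. -/
def deltaMap (M : Type) [AddCommGroup M] [Module A M] :
    M →ₗ[A] ((M →ₗ[A] ω) →ₗ[A] ω) :=
  (LinearMap.id : (M →ₗ[A] ω) →ₗ[A] (M →ₗ[A] ω)).flip

/-- The dual `f† = Hom(f, ω)` of a linear map `f`. -/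
def dmap {M N : Type} [AddCommGroup M] [Module A M] [AddCommGroup N] [Module A N]
    (f : M →ₗ[A] N) : (N →ₗ[A] ω) →ₗ[A] (M →ₗ[A] ω) :=
  LinearMap.lcomp A ω f

end delta

/-- The homology `ker g / im f` at the middle spot of `M → N → P`. -/
abbrev homMod (A : Type) [CommRing A] {M N P : Type} [AddCommGroup M] [Module A M]
    [AddCommGroup N] [Module A N] [AddCommGroup P] [Module A P]
    (f : M →ₗ[A] N) (g : N →ₗ[A] P) : Type :=
  ↥(LinearMap.ker g) ⧸ Submodule.comap (LinearMap.ker g).subtype (LinearMap.range f)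

end

section Comparison

variable {R : Type} [CommRing R]

lemma nonempty_homology_linearEquiv (S : ShortComplex (ModuleCat.{0} R)) {E : Type}
    [AddCommGroup E] [Module R E] (ψ : LinearMap.ker S.g.hom →ₗ[R] E)
    (hψ : Function.Surjective ψ)
    (hker : ∀ x, ψ x = 0 ↔ ∃ y, S.f.hom y = (x : S.X₂)) : Nonempty (S.homology ≃ₗ[R] E) := by
  have h : LinearMap.ker ψ = LinearMap.range S.moduleCatToCycles := by
    ext x
    rw [LinearMap.mem_ker, hker x]
    exact exists_congr fun y => ⟨fun h => Subtype.ext h, fun h => congrArg Subtype.val h⟩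
  exact ⟨S.moduleCatHomologyIso.toLinearEquiv ≪≫ₗ
    ((Submodule.quotEquivOfEq _ _ h).symm ≪≫ₗ ψ.quotKerEquivOfSurjective hψ)⟩

lemma extMk_eq_zero_iff' {X Y : ModuleCat.{0} R} (P : ProjectiveResolution X)
    (f : P.complex.X 0 ⟶ Y) (m : ℕ) (hm : 0 + 1 = m) (hf : P.complex.d m 0 ≫ f = 0) :
    P.extMk f m hm hf = 0 ↔ f = 0 := by
  simp only [← P.extEquivCohomologyClass.apply_eq_iff_eq,
    ProjectiveResolution.extEquivCohomologyClass_extMk,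
    ProjectiveResolution.extEquivCohomologyClass_zero,
    CochainComplex.HomComplex.CohomologyClass.mk_eq_zero_iff]
  rw [CochainComplex.HomComplex.Cocycle.toSingleMk_mem_coboundaries_iff _ _ _ _ _ 1 (by simp)]
  have hz : Limits.IsZero (P.cochainComplex.X 1) :=
    CochainComplex.isZero_of_isStrictlyLE _ 0 _
  constructor
  · rintro ⟨g, hg⟩
    rw [hz.eq_of_src g 0, Limits.comp_zero] at hg
    exact (cancel_epi (P.cochainComplexXIso (-(0 : ℕ)) 0 rfl).hom).1 (by simpa using hg.symm)
  · rintro rfl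
    exact ⟨0, by simp⟩

lemma smul_extMk {X Y : ModuleCat.{0} R} (P : ProjectiveResolution X) {n : ℕ}
    (f : P.complex.X n ⟶ Y) (m : ℕ) (hm : n + 1 = m) (hf : P.complex.d m n ≫ f = 0) (r : R) :
    r • P.extMk f m hm hf = P.extMk (r • f) m hm (by simp [hf]) := by
  rw [Abelian.Ext.smul_eq_comp_mk₀, P.extMk_comp_mk₀]
  congr 1

theorem nonempty_ext1_linearEquiv (n : ℕ) (M N : Type) [AddCommGroup M] [Module R M]
    [AddCommGroup N] [Module R N] :
    Nonempty (ext1 R n M N ≃ₗ[R] Abelian.Ext (ModuleCat.of R M) (ModuleCat.of R N) n) := by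
  let P := projectiveResolution (ModuleCat.of R M)
  let K := P.complex.linearYonedaObj R (ModuleCat.of R N)
  let Y := ModuleCat.of R N
  have hnext : (ComplexShape.up ℕ).next n = n + 1 := by simp
  have hmem (f : LinearMap.ker (K.sc n).g.hom) :
      P.complex.d (n + 1) n ≫ (f.1 : P.complex.X n ⟶ Y) = 0 := by
    obtain ⟨f, hf⟩ := f
    have : (K.d n ((ComplexShape.up ℕ).next n)).hom f = 0 := hf
    rw [hnext] at this
    exact this
  let ψ : LinearMap.ker (K.sc n).g.hom →ₗ[R] Abelian.Ext (ModuleCat.of R M) Y n :=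
    { toFun := fun f => P.extMk f.1 (n + 1) rfl (hmem f)
      map_add' := fun f g => (P.add_extMk _ _ _ _ _ _).symm
      map_smul' := fun r f => (smul_extMk P _ _ _ _ r).symm }
  obtain ⟨e⟩ := nonempty_homology_linearEquiv (K.sc n) ψ
    (by
      intro α
      obtain ⟨f, hf, rfl⟩ := P.extMk_surjective α (n + 1) rfl
      refine ⟨⟨f, ?_⟩, rfl⟩
      change (K.d n ((ComplexShape.up ℕ).next n)).hom f = 0
      rw [hnext]
      exact hf)
    (by
      rintro ⟨f, hf⟩
      have hf' := hmem ⟨f, hf⟩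
      change P.extMk f (n + 1) rfl hf' = 0 ↔
        ∃ y, (K.d ((ComplexShape.up ℕ).prev n) n).hom y = f
      cases n with
      | zero =>
        refine (extMk_eq_zero_iff' P f _ _ hf').trans ?_
        have h0 : K.d ((ComplexShape.up ℕ).prev 0) 0 = 0 := by
          apply K.shape; simp
        rw [h0]
        exact ⟨fun h => ⟨0, h.symm⟩, fun ⟨y, hy⟩ => hy.symm⟩
      | succ p =>
        have hprev : (ComplexShape.up ℕ).prev (p + 1) = p := by simp
        rw [hprev]
        exact P.extMk_eq_zero_iff f _ rfl hf' p rfl)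
  exact ⟨(P.isoExt (R := R) n Y).toLinearEquiv ≪≫ₗ e⟩

end Comparison

section ExtToolkit

open Abelian

/-- `Ext^n(N, W)` for unbundled modules `N` and `W`. -/
abbrev ExtMod (R : Type) [CommRing R] (N W : Type) [AddCommGroup N] [Module R N]
    [AddCommGroup W] [Module R W] (n : ℕ) : Type :=
  Ext (ModuleCat.of R N) (ModuleCat.of R W) n

variable {R : Type} [CommRing R]

section ShortExact

variable {N₁ N₂ N₃ : Type} [AddCommGroup N₁] [Module R N₁] [AddCommGroup N₂] [Module R N₂]
  [AddCommGroup N₃] [Module R N₃] {f : N₁ →ₗ[R] N₂} {g : N₂ →ₗ[R] N₃}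

/-- The short complex of modules attached to a pair of consecutive linear maps. -/
abbrev shortComplexOfLinear (f : N₁ →ₗ[R] N₂) (g : N₂ →ₗ[R] N₃) (h : Function.Exact f g) :
    ShortComplex (ModuleCat.{0} R) :=
  ShortComplex.mk (ModuleCat.ofHom f) (ModuleCat.ofHom g) (by
    ext x
    exact h.apply_apply_eq_zero x)

lemma shortExact_of_linear (hf : Function.Injective f) (hg : Function.Surjective g)
    (h : Function.Exact f g) : (shortComplexOfLinear f g h).ShortExact where
  exact := ModuleCat.shortComplex_exact _ h
  mono_f := (ModuleCat.mono_iff_injective _).2 hf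
  epi_g := (ModuleCat.epi_iff_surjective _).2 hg

variable (W : Type) [AddCommGroup W] [Module R W]

lemma subsingleton_extMod_middle (hf : Function.Injective f) (hg : Function.Surjective g)
    (h : Function.Exact f g) {n : ℕ} (h₁ : Subsingleton (ExtMod R N₁ W n))
    (h₃ : Subsingleton (ExtMod R N₃ W n)) : Subsingleton (ExtMod R N₂ W n) := by
  refine subsingleton_of_forall_eq 0 fun x => ?_
  obtain ⟨y, rfl⟩ := Ext.contravariant_sequence_exact₂ (shortExact_of_linear hf hg h) _ x
    (Subsingleton.elim (α := ExtMod R N₁ W n) _ _)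
  rw [Subsingleton.elim (α := ExtMod R N₃ W n) y 0, Ext.comp_zero]

lemma subsingleton_extMod_left (hf : Function.Injective f) (hg : Function.Surjective g)
    (h : Function.Exact f g) {n : ℕ} (h₂ : Subsingleton (ExtMod R N₂ W n))
    (h₃ : Subsingleton (ExtMod R N₃ W (n + 1))) : Subsingleton (ExtMod R N₁ W n) := by
  refine subsingleton_of_forall_eq 0 fun x => ?_
  obtain ⟨y, rfl⟩ := Ext.contravariant_sequence_exact₁ (shortExact_of_linear hf hg h) _ x
    (add_comm 1 n) (Subsingleton.elim (α := ExtMod R N₃ W (n + 1)) _ _)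
  rw [Subsingleton.elim (α := ExtMod R N₂ W n) y 0, Ext.comp_zero]

lemma subsingleton_extMod_covariant_right (hf : Function.Injective f)
    (hg : Function.Surjective g)
    (h : Function.Exact f g) {n : ℕ} (h₂ : Subsingleton (ExtMod R W N₂ n))
    (h₁ : Subsingleton (ExtMod R W N₁ (n + 1))) : Subsingleton (ExtMod R W N₃ n) := by
  refine subsingleton_of_forall_eq 0 fun x => ?_
  obtain ⟨y, rfl⟩ := Ext.covariant_sequence_exact₃ _ (shortExact_of_linear hf hg h) x rfl
    (Subsingleton.elim (α := ExtMod R W N₁ (n + 1)) _ _)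
  rw [Subsingleton.elim (α := ExtMod R W N₂ n) y 0, Ext.zero_comp]

lemma nonempty_extMod_connecting_linearEquiv (hf : Function.Injective f)
    (hg : Function.Surjective g)
    (h : Function.Exact f g) {n : ℕ} (h₂ : Subsingleton (ExtMod R N₂ W n))
    (h₂' : Subsingleton (ExtMod R N₂ W (n + 1))) :
    Nonempty (ExtMod R N₁ W n ≃ₗ[R] ExtMod R N₃ W (n + 1)) := by
  let S := shortExact_of_linear hf hg h
  refine ⟨LinearEquiv.ofBijective
    (S.extClass.precompOfLinear R (ModuleCat.of R W) (add_comm 1 n)) ⟨?_, ?_⟩⟩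
  · rw [injective_iff_map_eq_zero]
    intro x hx
    obtain ⟨y, rfl⟩ := Ext.contravariant_sequence_exact₁ S _ x (add_comm 1 n) hx
    rw [Subsingleton.elim (α := ExtMod R N₂ W n) y 0, Ext.comp_zero]
  · intro x
    exact Ext.contravariant_sequence_exact₃ S _ x
      (Subsingleton.elim (α := ExtMod R N₂ W (n + 1)) _ _) (add_comm 1 n)

end ShortExact

section Hom

variable {N N' W V : Type} [AddCommGroup N] [Module R N] [AddCommGroup N'] [Module R N']
  [AddCommGroup W] [Module R W] [AddCommGroup V] [Module R V]

/-- `Ext^0(N, W)` is `Hom(N, W)`. -/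
noncomputable def extModZeroEquiv (R N W : Type) [CommRing R] [AddCommGroup N] [Module R N]
    [AddCommGroup W] [Module R W] : ExtMod R N W 0 ≃ₗ[R] (N →ₗ[R] W) :=
  Ext.linearEquiv₀ ≪≫ₗ ModuleCat.homLinearEquiv

lemma extModZeroEquiv_symm_apply (u : N →ₗ[R] W) :
    (extModZeroEquiv R N W).symm u = Ext.mk₀ (ModuleCat.ofHom u) := rfl

lemma extModZeroEquiv_mk₀_comp (u : N' →ₗ[R] N) (x : ExtMod R N W 0) :
    extModZeroEquiv R N' W ((Ext.mk₀ (ModuleCat.ofHom u)).comp x (zero_add 0)) =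
      extModZeroEquiv R N W x ∘ₗ u := by
  obtain ⟨v, rfl⟩ := (extModZeroEquiv R N W).symm.surjective x
  rw [LinearEquiv.apply_symm_apply, extModZeroEquiv_symm_apply, Ext.mk₀_comp_mk₀,
    ← ModuleCat.ofHom_comp, ← extModZeroEquiv_symm_apply, LinearEquiv.apply_symm_apply]

lemma extModZeroEquiv_comp_mk₀ (u : W →ₗ[R] V) (x : ExtMod R N W 0) :
    extModZeroEquiv R N V (x.comp (Ext.mk₀ (ModuleCat.ofHom u)) (add_zero 0)) =
      u ∘ₗ extModZeroEquiv R N W x := by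
  obtain ⟨v, rfl⟩ := (extModZeroEquiv R N W).symm.surjective x
  rw [LinearEquiv.apply_symm_apply, extModZeroEquiv_symm_apply, Ext.mk₀_comp_mk₀,
    ← ModuleCat.ofHom_comp, ← extModZeroEquiv_symm_apply, LinearEquiv.apply_symm_apply]

lemma subsingleton_extMod_of_linearEquiv (e : N ≃ₗ[R] N') {n : ℕ}
    (h : Subsingleton (ExtMod R N W n)) : Subsingleton (ExtMod R N' W n) := by
  refine subsingleton_of_forall_eq 0 fun x => ?_
  have h1 : (Ext.mk₀ (ModuleCat.ofHom e.symm.toLinearMap)).comp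
      ((Ext.mk₀ (ModuleCat.ofHom e.toLinearMap)).comp x (zero_add n)) (zero_add n) = x := by
    rw [Ext.mk₀_comp_mk₀_assoc, ← ModuleCat.ofHom_comp]
    simp
  rw [← h1, Subsingleton.elim (α := ExtMod R N W n)
    ((Ext.mk₀ (ModuleCat.ofHom e.toLinearMap)).comp x (zero_add n)) 0, Ext.comp_zero]

lemma subsingleton_extMod_of_subsingleton [Subsingleton N] (n : ℕ) :
    Subsingleton (ExtMod R N W n) := by
  refine subsingleton_of_forall_eq 0 fun x => ?_
  have : (Ext.mk₀ (𝟙 (ModuleCat.of R N))) = 0 := by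
    rw [Ext.mk₀_eq_zero_iff]
    exact (ModuleCat.isZero_of_subsingleton _).eq_of_src _ _
  rw [← Ext.mk₀_id_comp x, this, Ext.zero_comp]

lemma extMod_mk₀_smul_id_comp (x : R) {n : ℕ} (y : ExtMod R N W n) :
    (Ext.mk₀ (x • 𝟙 (ModuleCat.of R N))).comp y (zero_add n) = x • y := by
  rw [Ext.mk₀_smul, Ext.smul_comp, Ext.mk₀_id_comp]

/-- Multiplying a class by a scalar that kills the first argument gives zero. -/
lemma extMod_smul_eq_zero_of_left {x : R} (hx : ∀ c : N, x • c = 0) {n : ℕ}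
    (y : ExtMod R N W n) : x • y = 0 := by
  have : x • 𝟙 (ModuleCat.of R N) = 0 := by
    ext c
    exact hx c
  rw [← extMod_mk₀_smul_id_comp, this, Ext.mk₀_zero, Ext.zero_comp]

end Hom

section Local

variable [IsLocalRing R] [IsNoetherianRing R]
variable {N W : Type} [AddCommGroup N] [Module R N]
  [AddCommGroup W] [Module R W] [Module.Finite R N] [Module.Finite R W]

lemma subsingleton_extMod_of_quotSMulTop {x : R} (hx : x ∈ IsLocalRing.maximalIdeal R)
    (hreg : IsSMulRegular N x) {n : ℕ}
    (h : Subsingleton (ExtMod R (QuotSMulTop x N) W (n + 1))) :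
    Subsingleton (ExtMod R N W n) := by
  have hS : ((ModuleCat.of R N).smulShortComplex x).ShortExact :=
    IsSMulRegular.smulShortComplex_shortExact (M := ModuleCat.of R N) hreg
  have key : ∀ y : ExtMod R N W n, ∃ z : ExtMod R N W n, x • z = y := by
    intro y
    obtain ⟨z, hz⟩ := Ext.contravariant_sequence_exact₁ hS _ y (add_comm 1 n)
      (Subsingleton.elim (α := ExtMod R (QuotSMulTop x N) W (n + 1)) _ _)
    exact ⟨z, (extMod_mk₀_smul_id_comp x z).symm.trans hz⟩
  have hfin : Module.Finite R (ExtMod R N W n) := inferInstance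
  have htop : (⊤ : Submodule R (ExtMod R N W n)) = ⊥ := by
    refine Submodule.eq_bot_of_le_smul_of_le_jacobson_bot (IsLocalRing.maximalIdeal R) _
      Module.Finite.fg_top (fun y _ => ?_) (IsLocalRing.maximalIdeal_le_jacobson _)
    obtain ⟨z, rfl⟩ := key y
    exact Submodule.smul_mem_smul hx trivial
  exact (Submodule.subsingleton_iff R).1 (subsingleton_of_bot_eq_top htop.symm)

end Local

end ExtToolkit

section Vanishing

open Abelian IsLocalRing RingTheory.Sequence

variable {R : Type} [CommRing R] [IsLocalRing R] [IsNoetherianRing R]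

/-- The residue field as a quotient module. -/
noncomputable def residueFieldEquiv (R : Type) [CommRing R] [IsLocalRing R] :
    (R ⧸ maximalIdeal R) ≃ₗ[R] ResidueField R :=
  LinearEquiv.refl R (R ⧸ maximalIdeal R)

instance : Module.Finite R (ResidueField R) :=
  Module.Finite.equiv (residueFieldEquiv R)

omit [IsNoetherianRing R] in
lemma support_residueField :
    Module.support R (ResidueField R) = PrimeSpectrum.zeroLocus (maximalIdeal R) := by
  rw [← (residueFieldEquiv R).support_eq, Module.support_eq_zeroLocus, Ideal.annihilator_quotient]

omit [IsNoetherianRing R] in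
lemma smul_residueField_eq_zero {x : R} (hx : x ∈ maximalIdeal R) (c : ResidueField R) :
    x • c = 0 := by
  rw [Algebra.smul_def]
  have : algebraMap R (ResidueField R) x = 0 := (residue_eq_zero_iff x).2 hx
  rw [this, zero_mul]

lemma exists_injective_residueField (N : Type) [AddCommGroup N] [Module R N] [Nontrivial N]
    (hN : Module.support R N ⊆ PrimeSpectrum.zeroLocus (maximalIdeal R)) :
    ∃ f : ResidueField R →ₗ[R] N, Function.Injective f := by
  obtain ⟨p, hp⟩ := associatedPrimes.nonempty R N
  obtain ⟨hp, f, hf⟩ := (isAssociatedPrime_iff_exists_injective_linearMap p N).1 hp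
  have hmem : (⟨p, hp⟩ : PrimeSpectrum R) ∈ Module.support R N := by
    refine Module.support_subset_of_injective f hf ?_
    rw [Module.support_eq_zeroLocus, Ideal.annihilator_quotient]
    exact le_refl (p : Set R)
  have hpm : maximalIdeal R = p := le_antisymm (hN hmem) (le_maximalIdeal hp.ne_top)
  subst hpm
  exact ⟨f ∘ₗ (residueFieldEquiv R).symm.toLinearMap,
    hf.comp (residueFieldEquiv R).symm.injective⟩

lemma exists_isRegular_of_subsingleton_extMod (W : Type) [AddCommGroup W] [Module R W]
    [Module.Finite R W] [Nontrivial W] (d : ℕ)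
    (h : ∀ i < d, Subsingleton (ExtMod R (ResidueField R) W i)) :
    ∃ rs : List R, rs.length = d ∧ (∀ r ∈ rs, r ∈ maximalIdeal R) ∧ IsRegular W rs := by
  refine ModuleCat.exists_isRegular_of_exists_subsingleton_ext (maximalIdeal R) d
    (ModuleCat.of R W) ?_ (ModuleCat.of R (ResidueField R)) support_residueField h
  refine lt_top_iff_ne_top.2 fun h => ?_
  exact Submodule.top_ne_ideal_smul_of_le_jacobson_annihilator
    (IsLocalRing.maximalIdeal_le_jacobson (Module.annihilator R W)) h.symm

lemma subsingleton_extMod_of_lt {d : ℕ} (hdim : ringKrullDim R = d)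
    (hR : ∀ i < d, Subsingleton (ExtMod R (ResidueField R) R i))
    (W : Type) [AddCommGroup W] [Module R W] [Module.Finite R W]
    (hW : ∃ m : ℕ, ∀ (N : Type) [AddCommGroup N] [Module R N], ∀ n, m < n →
      Subsingleton (ExtMod R N W n))
    (N : Type) [AddCommGroup N] [Module R N] [Module.Finite R N] {n : ℕ} (hn : d < n) :
    Subsingleton (ExtMod R N W n) := by
  obtain ⟨m, hm⟩ := hW
  by_cases hmn : m < n
  · exact hm N n hmn
  obtain ⟨rs, hlen, hrs, hreg⟩ := exists_isRegular_of_subsingleton_extMod R d hR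
  let Q := R ⧸ Ideal.ofList rs • (⊤ : Submodule R R)
  have hQ : ∀ n, d < n → Subsingleton (ExtMod R Q W n) := by
    intro n hn
    have hpd := ModuleCat.projectiveDimension_quotient_eq_add_length_of_isWeaklyRegular
      (ModuleCat.of R R) rs hreg.toIsWeaklyRegular hrs
    have h0 : projectiveDimension (ModuleCat.of R R) ≤ 0 :=
      (projectiveDimension_le_iff _ 0).2 inferInstance
    have hlt : HasProjectiveDimensionLT (ModuleCat.of R Q) (d + 1) := by
      refine (projectiveDimension_le_iff _ d).1 ?_
      refine hpd.le.trans ?_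
      rw [hlen]
      exact (add_le_add_left h0 _).trans (by simp)
    exact HasProjectiveDimensionLT.subsingleton _ (d + 1) n hn _
  have hQdim : Module.supportDim R Q = 0 := by
    have h1 := Module.supportDim_add_length_eq_supportDim_of_isRegular rs hreg
    rw [Module.supportDim_self_eq_ringKrullDim, hdim, hlen] at h1
    exact (ENat.WithBot.add_natCast_cancel (b := 0)).1 (h1.trans (zero_add _).symm)
  have hQn : Nontrivial Q := by
    rw [← Module.supportDim_ne_bot_iff_nontrivial R, hQdim]
    exact WithBot.coe_ne_bot
  obtain ⟨j, hj⟩ := exists_injective_residueField Q (support_of_supportDim_eq_zero _ _ hQdim).le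
  suffices H : ∀ i : ℕ, ∀ n, d < n → m < n + i → ∀ (N : Type) [AddCommGroup N] [Module R N]
      [Module.Finite R N], Subsingleton (ExtMod R N W n) by
    exact H (m + 1) n hn (by omega) N
  intro i
  induction i with
  | zero => intro n _ h N _ _ _; exact hm N n h
  | succ i ih =>
    intro n hn h N _ _ hN
    refine IsNoetherianRing.induction_on_isQuotientEquivQuotientPrime R
      (motive := fun N _ _ _ => Subsingleton (ExtMod R N W n)) hN ?_ ?_ ?_
    · intro N _ _ _ _
      exact subsingleton_extMod_of_subsingleton n
    · intro N _ _ _ p e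
      refine subsingleton_extMod_of_linearEquiv e.symm ?_
      by_cases hp : p.asIdeal = maximalIdeal R
      · rw [hp]
        refine subsingleton_extMod_of_linearEquiv (residueFieldEquiv R).symm ?_
        exact subsingleton_extMod_left W hj (Submodule.mkQ_surjective (LinearMap.range j))
          (LinearMap.exact_map_mkQ_range j) (hQ n hn) (ih (n + 1) (by omega) (by omega) _)
      · obtain ⟨x, hx, hxp⟩ := SetLike.exists_of_lt
          (lt_of_le_of_ne (le_maximalIdeal p.2.ne_top) hp)
        refine subsingleton_extMod_of_quotSMulTop hx ?_ (ih (n + 1) (by omega) (by omega) _)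
        rw [isSMulRegular_iff_right_eq_zero_of_smul]
        intro c hc
        obtain ⟨c, rfl⟩ := Ideal.Quotient.mk_surjective c
        rw [← Ideal.Quotient.mk_eq_mk, ← Submodule.Quotient.mk_smul, Ideal.Quotient.mk_eq_mk,
          Ideal.Quotient.eq_zero_iff_mem] at hc
        rw [Ideal.Quotient.eq_zero_iff_mem]
        exact (p.2.mem_or_mem hc).resolve_left hxp
    · intro N₁ _ _ _ N₂ _ _ _ N₃ _ _ _ f g hf hg hfg h₁ h₃
      exact subsingleton_extMod_middle W hf hg hfg h₁ h₃

lemma subsingleton_extMod_of_isWeaklyRegular {d : ℕ} (W : Type) [AddCommGroup W] [Module R W]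
    [Module.Finite R W]
    (hW : ∀ (N : Type) [AddCommGroup N] [Module R N] [Module.Finite R N], ∀ n, d < n →
      Subsingleton (ExtMod R N W n))
    (rs : List R) (hrs : ∀ r ∈ rs, r ∈ maximalIdeal R) :
    ∀ (C : Type) [AddCommGroup C] [Module R C] [Module.Finite R C], IsWeaklyRegular C rs →
      ∀ i, d < i + rs.length → Subsingleton (ExtMod R C W i) := by
  induction rs with
  | nil => intro C _ _ _ _ i hi; exact hW C i hi
  | cons x rs ih =>
    intro C _ _ _ hC i hi
    rw [isWeaklyRegular_cons_iff] at hC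
    refine subsingleton_extMod_of_quotSMulTop (hrs x List.mem_cons_self) hC.1 ?_
    refine ih (fun r hr => hrs r (List.mem_cons_of_mem _ hr)) _ hC.2 _ ?_
    rw [List.length_cons] at hi
    omega

end Vanishing

section RegularQuotient

open Abelian RingTheory.Sequence
open scoped Pointwise

variable {R : Type} [CommRing R]

lemma shortExact_lsmul_mkQ {W : Type} [AddCommGroup W] [Module R W] {x : R}
    (hx : IsSMulRegular W x) :
    (shortComplexOfLinear (LinearMap.lsmul R W x) (x • (⊤ : Submodule R W)).mkQ
      (LinearMap.exact_lsmul_mkQ_smul_top W x)).ShortExact :=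
  shortExact_of_linear (f := LinearMap.lsmul R W x) hx (Submodule.mkQ_surjective _) _

lemma extMod_comp_mk₀_lsmul {N W : Type} [AddCommGroup N] [Module R N] [AddCommGroup W]
    [Module R W] (x : R) {n : ℕ} (y : ExtMod R N W n) :
    y.comp (Ext.mk₀ (ModuleCat.ofHom (LinearMap.lsmul R W x))) (add_zero n) = x • y := by
  have : ModuleCat.ofHom (LinearMap.lsmul R W x) = x • 𝟙 (ModuleCat.of R W) := rfl
  rw [this, Ext.mk₀_smul, Ext.comp_smul, Ext.comp_mk₀_id]

variable {N : Type} [AddCommGroup N] [Module R N]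

/-- `Ext^i(N, W)` vanishes below the length of a `W`-regular sequence annihilating `N`. -/
lemma subsingleton_extMod_of_lt_length {rs : List R} (hN : ∀ r ∈ rs, ∀ c : N, r • c = 0) :
    ∀ (W : Type) [AddCommGroup W] [Module R W], IsWeaklyRegular W rs →
      ∀ i < rs.length, Subsingleton (ExtMod R N W i) := by
  induction rs with
  | nil => intro W _ _ _ i hi; simp at hi
  | cons x rs ih =>
    intro W _ _ hW i hi
    rw [isWeaklyRegular_cons_iff] at hW
    have hx := shortExact_lsmul_mkQ hW.1
    refine subsingleton_of_forall_eq 0 fun y => ?_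
    have hy : y.comp (Ext.mk₀ (ModuleCat.ofHom (LinearMap.lsmul R W x))) (add_zero i) = 0 := by
      rw [extMod_comp_mk₀_lsmul]
      exact extMod_smul_eq_zero_of_left (hN x List.mem_cons_self) y
    cases i with
    | zero =>
      obtain ⟨u, rfl⟩ := (extModZeroEquiv R N W).symm.surjective y
      have h1 := congrArg (extModZeroEquiv R N W) hy
      rw [extModZeroEquiv_comp_mk₀, LinearEquiv.apply_symm_apply, map_zero] at h1
      have : u = 0 := by
        ext c
        exact hW.1.right_eq_zero_of_smul (LinearMap.congr_fun h1 c)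
      rw [this, map_zero]
    | succ i =>
      obtain ⟨z, rfl⟩ := Ext.covariant_sequence_exact₁ _ hx y hy rfl
      have := ih (fun r hr => hN r (List.mem_cons_of_mem _ hr)) _ hW.2 i (by
        rw [List.length_cons] at hi
        omega)
      rw [Subsingleton.elim (α := ExtMod R N (QuotSMulTop x W) i) z 0, Ext.zero_comp]

/-- A `W`-regular sequence of length `n` annihilating `N` embeds `Hom(N, W/rs W)`
into `Ext^n(N, W)`. -/
lemma exists_injective_extMod_length {rs : List R} (hN : ∀ r ∈ rs, ∀ c : N, r • c = 0) :
    ∀ (W : Type) [AddCommGroup W] [Module R W], IsWeaklyRegular W rs →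
      ∃ F : (N →ₗ[R] W ⧸ Ideal.ofList rs • (⊤ : Submodule R W)) →ₗ[R]
        ExtMod R N W rs.length, Function.Injective F := by
  induction rs with
  | nil =>
    intro W _ _ _
    let e : (W ⧸ Ideal.ofList ([] : List R) • (⊤ : Submodule R W)) ≃ₗ[R] W :=
      Submodule.quotEquivOfEqBot _ (by simp)
    exact ⟨((LinearEquiv.congrRight e).trans (extModZeroEquiv R N W).symm).toLinearMap,
      ((LinearEquiv.congrRight e).trans (extModZeroEquiv R N W).symm).injective⟩
  | cons x rs ih =>
    intro W _ _ hW
    have hzero := subsingleton_extMod_of_lt_length hN W hW rs.length (by simp)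
    rw [isWeaklyRegular_cons_iff] at hW
    have hx := shortExact_lsmul_mkQ hW.1
    obtain ⟨F, hF⟩ := ih (fun r hr => hN r (List.mem_cons_of_mem _ hr)) _ hW.2
    let e := Submodule.quotOfListConsSMulTopEquivQuotSMulTopInner W x rs
    let D : ExtMod R N (QuotSMulTop x W) rs.length →ₗ[R] ExtMod R N W (rs.length + 1) :=
      hx.extClass.postcompOfLinear R (ModuleCat.of R N) rfl
    have hD : Function.Injective D := by
      rw [injective_iff_map_eq_zero]
      intro z hz
      obtain ⟨y, rfl⟩ := Ext.covariant_sequence_exact₃ _ hx z rfl hz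
      rw [Subsingleton.elim (α := ExtMod R N W rs.length) y 0, Ext.zero_comp]
    exact ⟨D ∘ₗ F ∘ₗ (LinearEquiv.congrRight e).toLinearMap,
      hD.comp (hF.comp (LinearEquiv.congrRight e).injective)⟩

/-- If restriction `Ext^n(N, W) → Ext^n(N', W)` is surjective, where `n` is the length of a
`W`-regular sequence annihilating `N`, then maps `N' → W/rs W` extend to `N`. -/
lemma exists_extension_of_restriction_surjective {N' : Type} [AddCommGroup N'] [Module R N']
    (j : N' →ₗ[R] N) (hj : Function.Injective j)
    {rs : List R} (hN : ∀ r ∈ rs, ∀ c : N, r • c = 0) :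
    ∀ (W : Type) [AddCommGroup W] [Module R W], IsWeaklyRegular W rs →
      (∀ y : ExtMod R N' W rs.length, ∃ z : ExtMod R N W rs.length,
        (Ext.mk₀ (ModuleCat.ofHom j)).comp z (zero_add _) = y) →
      ∀ h : N' →ₗ[R] W ⧸ Ideal.ofList rs • (⊤ : Submodule R W),
        ∃ h' : N →ₗ[R] W ⧸ Ideal.ofList rs • (⊤ : Submodule R W), h' ∘ₗ j = h := by
  induction rs with
  | nil =>
    intro W _ _ _ hsurj h
    let e : (W ⧸ Ideal.ofList ([] : List R) • (⊤ : Submodule R W)) ≃ₗ[R] W :=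
      Submodule.quotEquivOfEqBot _ (by simp)
    obtain ⟨z, hz⟩ := hsurj ((extModZeroEquiv R N' W).symm (e.toLinearMap ∘ₗ h))
    have h1 := congrArg (extModZeroEquiv R N' W) hz
    have h2 := (extModZeroEquiv_mk₀_comp j z).symm.trans h1
    rw [LinearEquiv.apply_symm_apply] at h2
    refine ⟨e.symm.toLinearMap ∘ₗ extModZeroEquiv R N W z, ?_⟩
    rw [LinearMap.comp_assoc, h2, ← LinearMap.comp_assoc]
    simp
  | cons x rs ih =>
    intro W _ _ hW hsurj h
    have hN' : ∀ r ∈ x :: rs, ∀ c : N', r • c = 0 := fun r hr c => hj (by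
      rw [map_smul, hN r hr, map_zero])
    have hzero := subsingleton_extMod_of_lt_length hN' W hW rs.length (by simp)
    rw [isWeaklyRegular_cons_iff] at hW
    have hx := shortExact_lsmul_mkQ hW.1
    let e := Submodule.quotOfListConsSMulTopEquivQuotSMulTopInner W x rs
    obtain ⟨h', hh'⟩ := ih (fun r hr => hN r (List.mem_cons_of_mem _ hr)) (QuotSMulTop x W) hW.2
      (fun y => by
        obtain ⟨z, hz⟩ := hsurj (y.comp hx.extClass rfl)
        obtain ⟨w, rfl⟩ := Ext.covariant_sequence_exact₁ _ hx z (by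
          refine (extMod_comp_mk₀_lsmul x z).trans ?_
          exact extMod_smul_eq_zero_of_left (hN x List.mem_cons_self) z) rfl
        refine ⟨w, ?_⟩
        rw [← sub_eq_zero]
        obtain ⟨v, hv⟩ := Ext.covariant_sequence_exact₃ _ hx
          ((Ext.mk₀ (ModuleCat.ofHom j)).comp w (zero_add _) - y) rfl (by
            rw [sub_eq_add_neg, Ext.add_comp, Ext.neg_comp, ← sub_eq_add_neg, sub_eq_zero, ← hz]
            exact Ext.comp_assoc _ _ _ _ _ (by omega))
        rw [← hv, Subsingleton.elim (α := ExtMod R N' W rs.length) v 0, Ext.zero_comp])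
      (e.toLinearMap ∘ₗ h)
    refine ⟨e.symm.toLinearMap ∘ₗ h', ?_⟩
    rw [LinearMap.comp_assoc, hh', ← LinearMap.comp_assoc]
    simp

/-- If `Ext^i(C, W) = 0` for `i > 0` then a map `C → W` with image in `rs W` lies in
`rs Hom(C, W)`. -/
lemma mem_smul_hom_of_forall_mem {C : Type} [AddCommGroup C] [Module R C] (rs : List R) :
    ∀ (W : Type) [AddCommGroup W] [Module R W], IsWeaklyRegular W rs →
      (∀ i, 0 < i → Subsingleton (ExtMod R C W i)) → ∀ h : C →ₗ[R] W,
      (∀ c, h c ∈ Ideal.ofList rs • (⊤ : Submodule R W)) →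
      h ∈ Ideal.ofList rs • (⊤ : Submodule R (C →ₗ[R] W)) := by
  induction rs with
  | nil =>
    intro W _ _ _ _ h hh
    have : h = 0 := by
      ext c
      simpa using hh c
    rw [this]
    exact zero_mem _
  | cons x rs ih =>
    intro W _ _ hW hext h hh
    rw [isWeaklyRegular_cons_iff] at hW
    have hx := shortExact_lsmul_mkQ hW.1
    let q := (x • (⊤ : Submodule R W)).mkQ
    have hq := ih (QuotSMulTop x W) hW.2 (fun i hi => subsingleton_extMod_covariant_right C
      (f := LinearMap.lsmul R W x) hW.1
      (Submodule.mkQ_surjective _) (LinearMap.exact_lsmul_mkQ_smul_top W x)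
      (hext i hi) (hext (i + 1) (by omega))) (q ∘ₗ h) (fun c => by
        have h1 := Submodule.mem_map_of_mem (f := q) (hh c)
        rw [Ideal.ofList_cons, Submodule.sup_smul, Submodule.map_sup, Submodule.map_smul'',
          Submodule.map_smul''] at h1
        refine (sup_le ?_ ?_ : _ ≤ Ideal.ofList rs • (⊤ : Submodule R (QuotSMulTop x W))) h1
        · rw [Submodule.smul_le]
          intro r hr c _
          obtain ⟨a, rfl⟩ := Ideal.mem_span_singleton'.1 hr
          have : x • c = 0 := by
            obtain ⟨c, rfl⟩ := Submodule.mkQ_surjective _ c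
            rw [← map_smul]
            exact (Submodule.Quotient.mk_eq_zero _).2
              (Submodule.smul_mem_pointwise_smul c x ⊤ trivial)
          rw [mul_smul, this, smul_zero]
          exact zero_mem _
        · exact Submodule.smul_mono le_rfl le_top)
    have hsurj : ∀ v : C →ₗ[R] QuotSMulTop x W, ∃ u : C →ₗ[R] W, q ∘ₗ u = v := by
      intro v
      obtain ⟨y, hy⟩ := Ext.covariant_sequence_exact₃ _ hx ((extModZeroEquiv R C _).symm v) rfl
        (by have := hext 1 one_pos; exact Subsingleton.elim (α := ExtMod R C W 1) _ _)
      refine ⟨extModZeroEquiv R C W y, ?_⟩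
      have h1 := congrArg (extModZeroEquiv R C (QuotSMulTop x W)) hy
      exact (extModZeroEquiv_comp_mk₀ q y).symm.trans (h1.trans (LinearEquiv.apply_symm_apply _ _))
    have hmap : Submodule.map (LinearMap.compRight R (M := C) q)
        (Ideal.ofList rs • (⊤ : Submodule R (C →ₗ[R] W))) =
        Ideal.ofList rs • (⊤ : Submodule R (C →ₗ[R] QuotSMulTop x W)) := by
      have hrange : LinearMap.range (LinearMap.compRight R (M := C) q) = ⊤ :=
        LinearMap.range_eq_top.2 hsurj
      rw [Submodule.map_smul'', Submodule.map_top, hrange]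
    rw [← hmap] at hq
    obtain ⟨u, hu, huh⟩ := hq
    have hdiff : ∀ c, ∃ w : W, x • w = h c - u c := by
      intro c
      have h1 : q (h c - u c) = 0 := by
        rw [map_sub, sub_eq_zero]
        exact (LinearMap.congr_fun huh c).symm
      obtain ⟨w, -, hw⟩ := (Submodule.mem_smul_pointwise_iff_exists _ _ _).1
        ((Submodule.Quotient.mk_eq_zero _).1 h1)
      exact ⟨w, hw⟩
    choose v hv using hdiff
    let v' : C →ₗ[R] W :=
      { toFun := v
        map_add' := fun a b => hW.1 (by
          simp only [smul_add, hv, map_add]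
          abel)
        map_smul' := fun r a => hW.1 (by
          simp only [RingHom.id_apply, smul_comm x r, hv, map_smul, smul_sub]) }
    have : h = x • v' + u := by
      ext c
      exact eq_add_of_sub_eq (hv c).symm
    rw [this]
    refine add_mem (Submodule.smul_mem_smul ?_ trivial)
      (Submodule.smul_mono_left ?_ hu)
    · exact Ideal.subset_span List.mem_cons_self
    · exact Ideal.span_mono fun r hr => List.mem_cons_of_mem _ hr

end RegularQuotient

section Homothety

open Abelian IsLocalRing RingTheory.Sequence

variable {R : Type} [CommRing R] [IsLocalRing R] [IsNoetherianRing R]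

omit [IsLocalRing R] [IsNoetherianRing R] in
lemma exists_comp_eq_of_ker_le {A B C : Type} [AddCommGroup A] [Module R A] [AddCommGroup B]
    [Module R B] [AddCommGroup C] [Module R C] {p : A →ₗ[R] B} (hp : Function.Surjective p)
    {φ : A →ₗ[R] C} (h : LinearMap.ker p ≤ LinearMap.ker φ) : ∃ ψ : B →ₗ[R] C, ψ ∘ₗ p = φ := by
  refine ⟨Submodule.liftQ _ φ h ∘ₗ (p.quotKerEquivOfSurjective hp).symm.toLinearMap,
    LinearMap.ext fun a => ?_⟩
  have : (p.quotKerEquivOfSurjective hp).symm (p a) = Submodule.Quotient.mk a := by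
    rw [LinearEquiv.symm_apply_eq]
    rfl
  change Submodule.liftQ _ φ h ((p.quotKerEquivOfSurjective hp).symm (p a)) = φ a
  rw [this]
  rfl

/-- If maps into `E` extend along injections of finite modules killed by `ann E`, and `Hom(k, E)`
is cyclic, then finite modules killed by `ann E` have surjective evaluation map to
their `E`-bidual. -/
lemma exists_eq_eval_of_extension (E : Type) [AddCommGroup E] [Module R E] [Module.Finite R E]
    (hsupp : Module.support R E ⊆ PrimeSpectrum.zeroLocus (maximalIdeal R))
    (hcyc : ∃ u : ResidueField R →ₗ[R] E, ∀ h : ResidueField R →ₗ[R] E, ∃ r : R, h = r • u)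
    (hext : ∀ (N' N : Type) [AddCommGroup N'] [Module R N'] [AddCommGroup N] [Module R N]
      [Module.Finite R N] (j : N' →ₗ[R] N), Function.Injective j →
      (∀ r ∈ Module.annihilator R E, ∀ c : N, r • c = 0) →
      ∀ h : N' →ₗ[R] E, ∃ h' : N →ₗ[R] E, h' ∘ₗ j = h)
    (N : Type) [AddCommGroup N] [Module R N] [Module.Finite R N]
    (hN : ∀ r ∈ Module.annihilator R E, ∀ c : N, r • c = 0) (φ : (N →ₗ[R] E) →ₗ[R] E) :
    ∃ c : N, ∀ h : N →ₗ[R] E, φ h = h c := by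
  refine IsNoetherianRing.induction_on_isQuotientEquivQuotientPrime R
    (motive := fun N _ _ _ => (∀ r ∈ Module.annihilator R E, ∀ c : N, r • c = 0) →
      ∀ φ : (N →ₗ[R] E) →ₗ[R] E, ∃ c : N, ∀ h : N →ₗ[R] E, φ h = h c)
    ‹Module.Finite R N› ?_ ?_ ?_ hN φ
  · intro N _ _ _ _ _ φ
    refine ⟨0, fun h => ?_⟩
    rw [Subsingleton.elim h 0, map_zero, map_zero]
  · intro N _ _ _ p e hN φ
    have hp : p.asIdeal = maximalIdeal R := by
      refine le_antisymm (le_maximalIdeal p.2.ne_top) (hsupp ?_)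
      rw [Module.support_eq_zeroLocus]
      intro r hr
      have h1 := congrArg e (hN r hr (e.symm 1))
      rw [map_smul, LinearEquiv.apply_symm_apply, map_zero] at h1
      exact Ideal.Quotient.eq_zero_iff_mem.1 ((Algebra.algebraMap_eq_smul_one r).trans h1)
    let e' : N ≃ₗ[R] ResidueField R :=
      e ≪≫ₗ Submodule.quotEquivOfEq _ _ hp ≪≫ₗ residueFieldEquiv R
    obtain ⟨u, hu⟩ := hcyc
    have hk : ∀ r ∈ maximalIdeal R, r • φ (u ∘ₗ e'.toLinearMap) = 0 := by
      intro r hr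
      rw [← map_smul]
      have : r • (u ∘ₗ e'.toLinearMap) = 0 := by
        ext c
        change r • u (e' c) = 0
        rw [← map_smul, smul_residueField_eq_zero hr, map_zero]
      rw [this, map_zero]
    let v : ResidueField R →ₗ[R] E :=
      Submodule.liftQ (maximalIdeal R) (LinearMap.toSpanSingleton R E (φ (u ∘ₗ e'.toLinearMap)))
        (fun r hr => hk r hr) ∘ₗ (residueFieldEquiv R).symm.toLinearMap
    have hv : v 1 = φ (u ∘ₗ e'.toLinearMap) := by
      change (1 : R) • φ (u ∘ₗ e'.toLinearMap) = _
      rw [one_smul]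
    obtain ⟨r, hr⟩ := hu v
    refine ⟨e'.symm (r • 1), fun h => ?_⟩
    obtain ⟨s, hs⟩ := hu (h ∘ₗ e'.symm.toLinearMap)
    have hh : h = s • (u ∘ₗ e'.toLinearMap) := by
      ext c
      have := LinearMap.congr_fun hs (e' c)
      simpa using this
    have h1 : φ (u ∘ₗ e'.toLinearMap) = r • u 1 := by
      rw [← hv, hr]
      rfl
    rw [hh, map_smul, h1]
    simp [smul_comm r s]
  · intro N₁ _ _ _ N₂ _ _ _ N₃ _ _ _ f g hf hg hfg h₁ h₃ hN φ
    have hN₁ : ∀ r ∈ Module.annihilator R E, ∀ c : N₁, r • c = 0 := fun r hr c =>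
      hf (by rw [map_smul, hN r hr, map_zero])
    have hN₃ : ∀ r ∈ Module.annihilator R E, ∀ c : N₃, r • c = 0 := fun r hr c => by
      obtain ⟨c, rfl⟩ := hg c
      rw [← map_smul, hN r hr, map_zero]
    obtain ⟨c, hc⟩ := h₃ hN₃ (φ ∘ₗ LinearMap.lcomp R E g)
    obtain ⟨c, rfl⟩ := hg c
    let φ' : (N₂ →ₗ[R] E) →ₗ[R] E := φ - LinearMap.applyₗ c
    have hres : Function.Surjective (LinearMap.lcomp R E f) := fun h => hext N₁ N₂ f hf hN h
    have hker : LinearMap.ker (LinearMap.lcomp R E f) ≤ LinearMap.ker φ' := by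
      intro h hh
      obtain ⟨h', hh'⟩ : ∃ h' : N₃ →ₗ[R] E, h' ∘ₗ g = h := by
        refine exists_comp_eq_of_ker_le hg fun c hc => ?_
        obtain ⟨a, rfl⟩ := (hfg c).1 hc
        exact LinearMap.congr_fun hh a
      have := hc h'
      rw [LinearMap.mem_ker]
      change φ h - h c = 0
      rw [sub_eq_zero, ← hh']
      exact this
    obtain ⟨ψ, hψ⟩ := exists_comp_eq_of_ker_le hres hker
    obtain ⟨c₁, hc₁⟩ := h₁ hN₁ ψ
    refine ⟨c + f c₁, fun h => ?_⟩
    have h1 : φ h - h c = ψ (h ∘ₗ f) := (LinearMap.congr_fun hψ h).symm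
    rw [hc₁] at h1
    rw [map_add, add_comm]
    exact eq_add_of_sub_eq h1

omit [IsLocalRing R] [IsNoetherianRing R] in
/-- In the situation of `exists_eq_eval_of_extension`, endomorphisms of `E` are homotheties. -/
lemma exists_eq_smul_of_forall_eval (E : Type) [AddCommGroup E] [Module R E]
    (heval : ∀ φ : ((R ⧸ Module.annihilator R E) →ₗ[R] E) →ₗ[R] E,
      ∃ c, ∀ h : (R ⧸ Module.annihilator R E) →ₗ[R] E, φ h = h c) (f : E →ₗ[R] E) :
    ∃ r : R, ∀ c, f c = r • c := by
  obtain ⟨a, ha⟩ := heval (f ∘ₗ LinearMap.applyₗ 1)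
  obtain ⟨r, rfl⟩ := Ideal.Quotient.mk_surjective a
  refine ⟨r, fun c => ?_⟩
  have h := ha (Submodule.liftQ _ (LinearMap.toSpanSingleton R E c)
    (fun s hs => Module.mem_annihilator.1 hs c))
  have h1 : f ((1 : R) • c) = r • c := h
  rwa [one_smul] at h1

/-- Endomorphisms of a module `W` with the homological properties of a canonical module
are homotheties. -/
theorem exists_eq_smul_id {d : ℕ} (hdim : ringKrullDim R = d)
    (W : Type) [AddCommGroup W] [Module R W] [Module.Finite R W] [Nontrivial W]
    (hext : ∀ (N : Type) [AddCommGroup N] [Module R N] [Module.Finite R N], ∀ n, d < n →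
      Subsingleton (ExtMod R N W n))
    {rs : List R} (hlen : rs.length = d) (hrs : ∀ r ∈ rs, r ∈ maximalIdeal R)
    (hreg : IsRegular W rs)
    (htype : Nonempty (ExtMod R (ResidueField R) W d ≃ₗ[R] ResidueField R))
    (f : W →ₗ[R] W) : ∃ r : R, f = r • LinearMap.id := by
  subst hlen
  have hWr := hreg.toIsWeaklyRegular
  let E := W ⧸ Ideal.ofList rs • (⊤ : Submodule R W)
  have hann : ∀ r ∈ rs, r ∈ Module.annihilator R E := by
    intro r hr
    rw [Module.mem_annihilator]
    intro c
    obtain ⟨c, rfl⟩ := Submodule.mkQ_surjective _ c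
    rw [← map_smul]
    exact (Submodule.Quotient.mk_eq_zero _).2
      (Submodule.smul_mem_smul (Ideal.subset_span hr) trivial)
  have hE : Nontrivial E :=
    Submodule.Quotient.nontrivial_iff.2 (Ne.symm hreg.top_ne_smul)
  have hsupp : Module.support R E = PrimeSpectrum.zeroLocus (maximalIdeal R) := by
    apply support_of_supportDim_eq_zero
    have h1 := Module.supportDim_add_length_eq_supportDim_of_isRegular rs hreg
    have h2 := Module.supportDim_le_ringKrullDim R W
    rw [← h1, hdim] at h2
    have h3 : Module.supportDim R E ≤ 0 :=
      (ENat.WithBot.add_le_add_natCast_right_iff (c := rs.length)).1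
        (h2.trans_eq (zero_add _).symm)
    refine le_antisymm h3 ?_
    have h4 := (Module.supportDim_ne_bot_iff_nontrivial R E).2 hE
    exact Order.krullDim_nonneg_iff.2 (Order.krullDim_ne_bot_iff.1 h4)
  have hcyc : ∃ u : ResidueField R →ₗ[R] E, ∀ h : ResidueField R →ₗ[R] E, ∃ r : R,
      h = r • u := by
    obtain ⟨t⟩ := htype
    obtain ⟨F, hF⟩ := exists_injective_extMod_length (N := ResidueField R)
      (fun r hr => smul_residueField_eq_zero (hrs r hr)) W hWr
    let G : (ResidueField R →ₗ[R] E) →ₗ[R] ResidueField R := t.toLinearMap ∘ₗ F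
    have hG : Function.Injective G := t.injective.comp hF
    by_cases h0 : ∃ u, G u ≠ 0
    · obtain ⟨u, hu⟩ := h0
      refine ⟨u, fun h => ?_⟩
      obtain ⟨r, hr⟩ := residue_surjective (G h / G u)
      refine ⟨r, hG ?_⟩
      rw [map_smul, Algebra.smul_def]
      exact (div_mul_cancel₀ (G h) hu).symm.trans (congrArg (· * G u) hr.symm)
    · push Not at h0
      exact ⟨0, fun h => ⟨0, hG (by rw [h0, h0])⟩⟩
  have hextend : ∀ (N' N : Type) [AddCommGroup N'] [Module R N'] [AddCommGroup N] [Module R N]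
      [Module.Finite R N] (j : N' →ₗ[R] N), Function.Injective j →
      (∀ r ∈ Module.annihilator R E, ∀ c : N, r • c = 0) →
      ∀ h : N' →ₗ[R] E, ∃ h' : N →ₗ[R] E, h' ∘ₗ j = h := by
    intro N' N _ _ _ _ _ j hj hN
    refine exists_extension_of_restriction_surjective j hj (fun r hr => hN r (hann r hr)) W hWr ?_
    intro y
    have := hext (N ⧸ LinearMap.range j) (rs.length + 1) (by omega)
    exact Ext.contravariant_sequence_exact₁ (shortExact_of_linear hj
      (Submodule.mkQ_surjective _) (LinearMap.exact_map_mkQ_range j)) _ y (add_comm 1 _)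
      (Subsingleton.elim (α := ExtMod R (N ⧸ LinearMap.range j) W (rs.length + 1)) _ _)
  have hEnd : ∀ f : E →ₗ[R] E, ∃ r : R, ∀ c, f c = r • c :=
    exists_eq_smul_of_forall_eval E (exists_eq_eval_of_extension E hsupp.le hcyc hextend _
      (fun r hr c => by
        obtain ⟨c, rfl⟩ := Ideal.Quotient.mk_surjective c
        exact Ideal.Quotient.eq_zero_iff_mem.2 (Ideal.mul_mem_right c _ hr)))
  have hW : ∀ i, 0 < i → Subsingleton (ExtMod R W W i) := fun i hi =>
    subsingleton_extMod_of_isWeaklyRegular W hext rs hrs W hWr i (by omega)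
  have htop : (⊤ : Submodule R (W →ₗ[R] W)) ≤ Submodule.span R {LinearMap.id} := by
    refine Submodule.le_of_le_smul_of_le_jacobson_bot (I := maximalIdeal R)
      Module.Finite.fg_top (maximalIdeal_le_jacobson _) fun f _ => ?_
    obtain ⟨r, hr⟩ := hEnd (Submodule.mapQ _ _ f (by
      rw [← Submodule.map_le_iff_le_comap, Submodule.map_smul'']
      exact Submodule.smul_mono le_rfl le_top))
    have hmem : f - r • LinearMap.id ∈ Ideal.ofList rs • (⊤ : Submodule R (W →ₗ[R] W)) := by
      refine mem_smul_hom_of_forall_mem rs W hWr hW _ fun c => ?_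
      rw [← Submodule.Quotient.mk_eq_zero]
      have := hr (Submodule.Quotient.mk c)
      rw [Submodule.mapQ_apply] at this
      change Submodule.Quotient.mk (f c - r • c) = _
      rw [Submodule.Quotient.mk_sub, this, Submodule.Quotient.mk_smul, sub_self]
    have hle : Ideal.ofList rs ≤ maximalIdeal R := Ideal.span_le.2 hrs
    have : f = r • LinearMap.id + (f - r • LinearMap.id) := by abel
    rw [this]
    exact Submodule.add_mem_sup (Submodule.smul_mem _ _ (Submodule.mem_span_singleton_self _))
      (Submodule.smul_mono_left hle hmem)
  obtain ⟨r, hr⟩ := Submodule.mem_span_singleton.1 (htop (Submodule.mem_top (x := f)))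
  exact ⟨r, hr.symm⟩

end Homothety

section Presentation

open Abelian IsLocalRing RingTheory.Sequence

variable {R : Type} [CommRing R]

lemma subsingleton_extMod_pi {N W : Type} [AddCommGroup N] [Module R N] [AddCommGroup W]
    [Module R W] {i : ℕ} (h : Subsingleton (ExtMod R N W i)) (n : ℕ) :
    Subsingleton (ExtMod R (Fin n → N) W i) := by
  induction n with
  | zero => exact subsingleton_extMod_of_subsingleton i
  | succ n ih =>
    refine subsingleton_extMod_of_linearEquiv (Fin.consLinearEquiv R fun _ => N) ?_
    exact subsingleton_extMod_middle W (f := LinearMap.inl R N (Fin n → N))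
      (g := LinearMap.snd R N (Fin n → N)) LinearMap.inl_injective LinearMap.snd_surjective
      .inl_snd h ih

lemma nontrivial_of_nontrivial_extMod {N W : Type} [AddCommGroup N] [Module R N]
    [AddCommGroup W] [Module R W] {i : ℕ} (h : Nontrivial (ExtMod R N W i)) : Nontrivial W := by
  by_contra hW
  rw [not_nontrivial_iff_subsingleton] at hW
  refine not_subsingleton _ (subsingleton_of_forall_eq (0 : ExtMod R N W i) fun y => ?_)
  have : (𝟙 (ModuleCat.of R W)) = 0 := (ModuleCat.isZero_of_subsingleton _).eq_of_src _ _
  rw [← Ext.comp_mk₀_id y, this, Ext.mk₀_zero, Ext.comp_zero]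

lemma subsingleton_extMod_of_le_rdepth [IsLocalRing R] {W : Type} [AddCommGroup W] [Module R W]
    {d : ℕ} (h : (d : ℕ∞) ≤ rdepth R W) {i : ℕ} (hi : i < d) :
    Subsingleton (ExtMod R (ResidueField R) W i) := by
  obtain ⟨e⟩ := nonempty_ext1_linearEquiv (R := R) i (ResidueField R) W
  by_contra hne
  have h1 : rdepth R W ≤ i := sInf_le ⟨i, rfl, fun hs => hne e.symm.toEquiv.subsingleton⟩
  exact absurd (Nat.cast_le.1 (h.trans h1)) (not_le.2 hi)

section Dual

variable {W : Type} [AddCommGroup W] [Module R W] {P : Type} [AddCommGroup P] [Module R P]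

lemma subsingleton_extMod_dual [IsLocalRing R] [Module.Finite R P] [Module.Projective R P]
    {i : ℕ} (h : Subsingleton (ExtMod R W W i)) :
    Subsingleton (ExtMod R (P →ₗ[R] W) W i) := by
  have : Module.Free R P := Module.free_of_flat_of_isLocalRing
  let b := Module.finBasis R P
  exact subsingleton_extMod_of_linearEquiv (b.constr R) (subsingleton_extMod_pi h _)

lemma deltaMap_surjective_of_projective [IsLocalRing R] [Module.Finite R P]
    [Module.Projective R P] (hW : ∀ f : W →ₗ[R] W, ∃ r : R, f = r • LinearMap.id) :
    Function.Surjective (deltaMap R W P) := by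
  have : Module.Free R P := Module.free_of_flat_of_isLocalRing
  let b := Module.finBasis R P
  intro φ
  choose r hr using fun i => hW (φ ∘ₗ (b.constr R).toLinearMap ∘ₗ
    LinearMap.single R (fun _ => W) i)
  refine ⟨∑ i, r i • b i, ?_⟩
  ext h
  change h (∑ i, r i • b i) = φ h
  have hh : h = ∑ i, b.constr R (Pi.single i (h (b i))) := by
    rw [← map_sum, Finset.univ_sum_single fun i => h (b i)]
    exact (b.constr_self R h).symm
  have h2 : ∀ i, φ (b.constr R (Pi.single i (h (b i)))) = r i • h (b i) := fun i =>
    LinearMap.congr_fun (hr i) (h (b i))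
  conv_rhs => rw [hh]
  simp only [map_sum, map_smul, h2]

end Dual

lemma nonempty_coker_deltaMap_linearEquiv [IsLocalRing R] {W : Type} [AddCommGroup W]
    [Module R W] (hext : ∀ i, 0 < i → Subsingleton (ExtMod R W W i))
    (hEnd : ∀ f : W →ₗ[R] W, ∃ r : R, f = r • LinearMap.id)
    {M P₀ P₁ : Type} [AddCommGroup M] [Module R M] [AddCommGroup P₀] [Module R P₀]
    [AddCommGroup P₁] [Module R P₁] [Module.Finite R P₀] [Module.Finite R P₁]
    [Module.Projective R P₀] [Module.Projective R P₁] (f : P₁ →ₗ[R] P₀) (g : P₀ →ₗ[R] M)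
    (hfg : Function.Exact f g) (hg : Function.Surjective g) :
    Nonempty ((((M →ₗ[R] W) →ₗ[R] W) ⧸ LinearMap.range (deltaMap R W M)) ≃ₗ[R]
      ExtMod R ((P₁ →ₗ[R] W) ⧸ LinearMap.range (dmap R W f)) W 2) := by
  let I := LinearMap.range (dmap R W f)
  obtain ⟨e⟩ := nonempty_extMod_connecting_linearEquiv W (n := 1)
    (f := I.subtype) (g := I.mkQ) I.injective_subtype I.mkQ_surjective
    (LinearMap.exact_subtype_mkQ I)
    (subsingleton_extMod_dual (hext 1 one_pos)) (subsingleton_extMod_dual (hext 2 two_pos))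
  have hinj : Function.Injective (dmap R W g) := fun a b hab => LinearMap.ext fun c => by
    obtain ⟨c, rfl⟩ := hg c
    exact LinearMap.congr_fun hab c
  have hexact : Function.Exact (dmap R W g) (dmap R W f).rangeRestrict := by
    intro h
    rw [← LinearMap.mem_ker, LinearMap.ker_rangeRestrict]
    constructor
    · intro hh
      refine exists_comp_eq_of_ker_le hg fun c hc => ?_
      obtain ⟨a, rfl⟩ := (hfg c).1 hc
      exact LinearMap.congr_fun hh a
    · rintro ⟨h, rfl⟩
      exact LinearMap.ext fun c => (congrArg h (hfg.apply_apply_eq_zero c)).trans (map_zero h)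
  have S := shortExact_of_linear hinj (dmap R W f).surjective_rangeRestrict hexact
  let D : ((M →ₗ[R] W) →ₗ[R] W) →ₗ[R] ExtMod R I W 1 :=
    S.extClass.precompOfLinear R (ModuleCat.of R W) rfl ∘ₗ
      (extModZeroEquiv R (M →ₗ[R] W) W).symm.toLinearMap
  have hD : Function.Surjective D := by
    intro y
    have h0 : Subsingleton (ExtMod R (P₀ →ₗ[R] W) W 1) := subsingleton_extMod_dual (hext 1 one_pos)
    obtain ⟨x, hx⟩ := Ext.contravariant_sequence_exact₃ S _ y
      (Subsingleton.elim (α := ExtMod R (P₀ →ₗ[R] W) W 1) _ _) (add_zero 1)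
    obtain ⟨ψ, rfl⟩ := (extModZeroEquiv R (M →ₗ[R] W) W).symm.surjective x
    exact ⟨ψ, hx⟩
  have hker : LinearMap.range (deltaMap R W M) = LinearMap.ker D := by
    ext ψ
    constructor
    · rintro ⟨c, rfl⟩
      obtain ⟨c, rfl⟩ := hg c
      have h1 : (extModZeroEquiv R (M →ₗ[R] W) W).symm (deltaMap R W M (g c)) =
          (Ext.mk₀ (ModuleCat.ofHom (dmap R W g))).comp
            ((extModZeroEquiv R (P₀ →ₗ[R] W) W).symm (deltaMap R W P₀ c)) (zero_add 0) := by
        rw [LinearEquiv.symm_apply_eq, extModZeroEquiv_mk₀_comp, LinearEquiv.apply_symm_apply]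
        rfl
      change S.extClass.comp ((extModZeroEquiv R (M →ₗ[R] W) W).symm (deltaMap R W M (g c)))
        rfl = 0
      rw [h1]
      exact S.extClass_comp_assoc _
    · intro hψ
      obtain ⟨x, hx⟩ := Ext.contravariant_sequence_exact₁ S _
        ((extModZeroEquiv R (M →ₗ[R] W) W).symm ψ) rfl hψ
      obtain ⟨c, hc⟩ := deltaMap_surjective_of_projective hEnd
        (extModZeroEquiv R (P₀ →ₗ[R] W) W x)
      refine ⟨g c, ?_⟩
      have h1 := congrArg (extModZeroEquiv R (M →ₗ[R] W) W) hx
      have h2 := (extModZeroEquiv_mk₀_comp (dmap R W g) x).symm.trans h1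
      rw [LinearEquiv.apply_symm_apply, ← hc] at h2
      exact h2
  exact ⟨Submodule.quotEquivOfEq _ _ hker ≪≫ₗ D.quotKerEquivOfSurjective hD ≪≫ₗ e⟩

end Presentation

/-- for a projective presentation `P₁ →f P₀ → M → 0` and the ω-transpose
`tr_ω M = coker (f† : P₀† → P₁†)`, one has `coker δ_M ≅ Ext^2(tr_ω M, ω)`. -/
theorem coker_delta_iso_ext_two_transpose (R : Type) [CommRing R] [IsNoetherianRing R]
    [IsLocalRing R]
    (d : ℕ) (hdim : ringKrullDim R = d) (hCM : (d : ℕ∞) ≤ rdepth R R)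
    (ω : Type) [AddCommGroup ω] [Module R ω] (hω : IsCanonicalModule R d ω)
    (M P0 P1 : Type) [AddCommGroup M] [Module R M] [AddCommGroup P0] [Module R P0]
    [AddCommGroup P1] [Module R P1]
    [Module.Finite R M] [Module.Finite R P0] [Module.Finite R P1]
    [Module.Projective R P0] [Module.Projective R P1]
    (f : P1 →ₗ[R] P0) (g : P0 →ₗ[R] M)
    (hfg : Function.Exact f g) (hg : Function.Surjective g) :
    Nonempty ((((M →ₗ[R] ω) →ₗ[R] ω) ⧸ LinearMap.range (deltaMap R ω M)) ≃ₗ[R]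
      ↥(ext1 R 2 ((P1 →ₗ[R] ω) ⧸ LinearMap.range (dmap R ω f)) ω)) := by
  obtain ⟨⟨hfin, hdepth⟩, ⟨m, hm⟩, ⟨t⟩⟩ := hω
  obtain ⟨e⟩ := nonempty_ext1_linearEquiv (R := R) d (IsLocalRing.ResidueField R) ω
  have hnt : Nontrivial ω := nontrivial_of_nontrivial_extMod (e.symm.trans t).nontrivial
  have hvan : ∀ (N : Type) [AddCommGroup N] [Module R N] [Module.Finite R N], ∀ n, d < n →
      Subsingleton (ExtMod R N ω n) := fun N _ _ _ n hn =>
    subsingleton_extMod_of_lt hdim (fun i hi => subsingleton_extMod_of_le_rdepth hCM hi) ω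
      ⟨m, fun N _ _ n hn => by
        obtain ⟨e⟩ := nonempty_ext1_linearEquiv (R := R) n N ω
        have := hm N n hn
        exact e.symm.toEquiv.subsingleton⟩ N hn
  obtain ⟨rs, hlen, hrs, hreg⟩ := exists_isRegular_of_subsingleton_extMod ω d
    fun i hi => subsingleton_extMod_of_le_rdepth hdepth hi
  obtain ⟨e₂⟩ := nonempty_ext1_linearEquiv (R := R) 2
    ((P1 →ₗ[R] ω) ⧸ LinearMap.range (dmap R ω f)) ω
  obtain ⟨e'⟩ := nonempty_coker_deltaMap_linearEquiv
    (fun i hi => subsingleton_extMod_of_isWeaklyRegular ω hvan rs hrs ω hreg.toIsWeaklyRegular i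
      (by omega))
    (exists_eq_smul_id hdim ω hvan hlen hrs hreg ⟨e.symm.trans t⟩) f g hfg hg
  exact ⟨e'.trans e₂.symm⟩
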